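/- Let p ≥ 1 and let G be a finite simple graph with independence number α(G) = r. Then G is α-critical and belongs to W_p if and only if the following three conditions all hold: G is well-covered; |F_G(S)| ≥ p for every independent set S of G with |S| = r − 1; and E(G) equals the union, over all independent sets S of G with |S| = r − 1, of the set of all 2-element subsets of F_G(S). -/

import Mathlib

open Finset
open scoped Classical

/-- `S` is an independent set of the graph `G`. -/
def IsIndep {V : Type*} (G : SimpleGraph V) (S : Finset V) : Prop :=
  ∀ ⦃x⦄, x ∈ S → ∀ ⦃y⦄, y ∈ S → x ≠ y → ¬ G.Adj x y

/-- The independence number `α(G)` of a finite graph `G`. -/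
noncomputable def alpha {V : Type*} [Fintype V] (G : SimpleGraph V) : ℕ :=
  Finset.univ.sup fun S : Finset V => if IsIndep G S then S.card else 0

/-- `S` is a maximum independent set of `G`. -/
def IsMaxIndep {V : Type*} [Fintype V] (G : SimpleGraph V) (S : Finset V) : Prop :=
  IsIndep G S ∧ S.card = alpha G

/-- `S` is a maximal (inclusion-wise) independent set of `G`. -/
def IsMaximalIndep {V : Type*} [DecidableEq V] (G : SimpleGraph V) (S : Finset V) : Prop :=
  IsIndep G S ∧ ∀ x, x ∉ S → ¬ IsIndep G (insert x S)

/-- `G` is well-covered: every maximal independent set has cardinality `α(G)`. -/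
def WellCovered {V : Type*} [Fintype V] [DecidableEq V] (G : SimpleGraph V) : Prop :=
  ∀ S : Finset V, IsMaximalIndep G S → S.card = alpha G

/-- `G ∈ W_p`: `|V(G)| ≥ p` and every `p` pairwise disjoint independent sets extend to
`p` pairwise disjoint maximum independent sets. -/
def MemW {V : Type*} [Fintype V] (G : SimpleGraph V) (p : ℕ) : Prop :=
  p ≤ Fintype.card V ∧
    ∀ A : Fin p → Finset V, (∀ i, IsIndep G (A i)) →
      (∀ i j, i ≠ j → Disjoint (A i) (A j)) →
      ∃ M : Fin p → Finset V, (∀ i, IsMaxIndep G (M i)) ∧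
        (∀ i j, i ≠ j → Disjoint (M i) (M j)) ∧ ∀ i, A i ⊆ M i

/-- The `W`-index of `G`: the largest `p` with `G ∈ W_p`. -/
noncomputable def wIndex {V : Type*} [Fintype V] (G : SimpleGraph V) : ℕ :=
  sSup {p : ℕ | MemW G p}

/-- The fiber `F_G(S)`: the vertices `x ∉ S` with `S ∪ {x}` a maximum independent set. -/
noncomputable def fiber {V : Type*} [Fintype V] [DecidableEq V]
    (G : SimpleGraph V) (S : Finset V) : Finset V :=
  Finset.univ.filter fun x => x ∉ S ∧ IsMaxIndep G (insert x S)

/-- `G` is `α`-critical: deleting any edge increases the independence number. -/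
def AlphaCritical {V : Type*} [Fintype V] (G : SimpleGraph V) : Prop :=
  ∀ x y, G.Adj x y → alpha G < alpha (G.deleteEdges {s(x, y)})

/-- `H` is `K_t`-saturated: `H` is `K_t`-free but adding any missing edge creates a `K_t`. -/
def KSaturated {V : Type*} [Fintype V] (H : SimpleGraph V) (t : ℕ) : Prop :=
  (∀ Q : Finset V, ¬ H.IsNClique t Q) ∧
    ∀ x y : V, x ≠ y → ¬ H.Adj x y →
      ∃ Q : Finset V, (H ⊔ SimpleGraph.fromEdgeSet {s(x, y)}).IsNClique t Q

/-- `Q` is an inclusion-maximal clique of `H`. -/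
def IsMaximalClique {V : Type*} [DecidableEq V] (H : SimpleGraph V) (Q : Finset V) : Prop :=
  H.IsClique (Q : Set V) ∧ ∀ x, x ∉ Q → ¬ H.IsClique ((insert x Q : Finset V) : Set V)

/-- The `(r-1)`-clique-codegree of `Q` in `H`: the number of vertices extending `Q`
to an `r`-clique of `H`. -/
noncomputable def codeg {V : Type*} [Fintype V] [DecidableEq V]
    (H : SimpleGraph V) (r : ℕ) (Q : Finset V) : ℕ :=
  (Finset.univ.filter fun x => x ∉ Q ∧ H.IsNClique r (insert x Q)).card

/-- The minimum `(r-1)`-clique-codegree `δ^cl_{r-1}(H)`. -/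
noncomputable def minCliqueCodeg {V : Type*} [Fintype V] [DecidableEq V]
    (H : SimpleGraph V) (r : ℕ) : ℕ :=
  sInf {m : ℕ | ∃ Q : Finset V, H.IsNClique (r - 1) Q ∧ codeg H r Q = m}

/-- The vertex set of the localization `G_S = G - N_G[S]`. -/
noncomputable def localVerts {V : Type*} [Fintype V] (G : SimpleGraph V) (S : Finset V) :
    Finset V :=
  Finset.univ.filter fun v => v ∉ S ∧ ∀ s ∈ S, ¬ G.Adj s v

/-- The localization `G_S = G - N_G[S]`, as an induced subgraph. -/
noncomputable def localize {V : Type*} [Fintype V] (G : SimpleGraph V) (S : Finset V) :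
    SimpleGraph {v : V // v ∈ localVerts G S} :=
  SimpleGraph.comap (fun v => (v : V)) G

/-- The vertex set of the edge-localization `G_{ab} = G - (N_G(a) ∪ N_G(b))`. -/
noncomputable def edgeVerts {V : Type*} [Fintype V] (G : SimpleGraph V) (a b : V) : Finset V :=
  Finset.univ.filter fun v => ¬ G.Adj a v ∧ ¬ G.Adj b v

/-- The edge-localization `G_{ab} = G - (N_G(a) ∪ N_G(b))`, as an induced subgraph. -/
noncomputable def edgeLocalize {V : Type*} [Fintype V] (G : SimpleGraph V) (a b : V) :
    SimpleGraph {v : V // v ∈ edgeVerts G a b} :=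
  SimpleGraph.comap (fun v => (v : V)) G

section Independence

variable {V : Type*} {G : SimpleGraph V}

theorem IsIndep.mono {S T : Finset V} (hT : IsIndep G T) (h : S ⊆ T) : IsIndep G S :=
  fun _ hx _ hy => hT (h hx) (h hy)

theorem isIndep_empty : IsIndep G ∅ := fun _ hx => absurd hx (Finset.notMem_empty _)

theorem isIndep_singleton (v : V) : IsIndep G {v} := by
  intro x hx y hy hxy
  exact absurd ((Finset.mem_singleton.1 hx).trans (Finset.mem_singleton.1 hy).symm) hxy

variable [Fintype V]

theorem IsIndep.card_le_alpha {S : Finset V} (hS : IsIndep G S) : S.card ≤ alpha G := by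
  have h := Finset.le_sup (f := fun S : Finset V => if IsIndep G S then S.card else 0)
    (Finset.mem_univ S)
  rwa [if_pos hS] at h

theorem exists_isMaxIndep (G : SimpleGraph V) : ∃ S, IsMaxIndep G S := by
  obtain ⟨S, -, hS⟩ := Finset.exists_mem_eq_sup (Finset.univ : Finset (Finset V))
    Finset.univ_nonempty fun S => if IsIndep G S then S.card else 0
  by_cases h : IsIndep G S
  · exact ⟨S, h, by rw [alpha, hS, if_pos h]⟩
  · refine ⟨∅, isIndep_empty, ?_⟩
    rw [alpha, hS, if_neg h, Finset.card_empty]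

theorem MemW.alpha_pos {p : ℕ} (hp : 1 ≤ p) (hG : MemW G p) : 1 ≤ alpha G := by
  obtain ⟨v⟩ : Nonempty V := Fintype.card_pos_iff.1 (hp.trans hG.1)
  simpa using (isIndep_singleton (G := G) v).card_le_alpha

variable [DecidableEq V]

theorem mem_fiber {S : Finset V} {x : V} :
    x ∈ fiber G S ↔ x ∉ S ∧ IsMaxIndep G (insert x S) := by
  simp [fiber]

/-- Fibers are cliques. -/
theorem adj_of_mem_fiber {S : Finset V} {x y : V} (hx : x ∈ fiber G S) (hy : y ∈ fiber G S)
    (hxy : x ≠ y) : G.Adj x y := by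
  rw [mem_fiber] at hx hy
  obtain ⟨hxS, hxi, hxc⟩ := hx
  obtain ⟨hyS, hyi, -⟩ := hy
  by_contra hadj
  have hind : IsIndep G (insert y (insert x S)) := by
    intro a ha b hb hab
    have hadj' : ¬ G.Adj y x := fun h => hadj h.symm
    by_cases hay : a = y <;> by_cases hby : b = y
    · exact absurd (hay.trans hby.symm) hab
    · by_cases hbx : b = x
      · rwa [hay, hbx]
      · exact hyi (by simp [hay]) (by simp_all) hab
    · by_cases hax : a = x
      · rwa [hax, hby]
      · exact hyi (by simp_all) (by simp [hby]) hab
    · exact hxi (by simp_all) (by simp_all) hab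
  have hle := hind.card_le_alpha
  rw [Finset.card_insert_of_notMem (by simp [hyS, hxy.symm])] at hle
  omega

theorem WellCovered.exists_isMaxIndep_superset (hG : WellCovered G) {S : Finset V}
    (hS : IsIndep G S) : ∃ M, IsMaxIndep G M ∧ S ⊆ M := by
  obtain ⟨M, hSM, hM⟩ := (Set.toFinite {T : Finset V | IsIndep G T}).exists_le_maximal hS
  refine ⟨M, ⟨hM.prop, hG M ⟨hM.prop, fun x hx hins => hx ?_⟩⟩, hSM⟩
  exact hM.le_of_ge hins (Finset.subset_insert x M) (Finset.mem_insert_self x M)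

theorem MemW.wellCovered {p : ℕ} (hp : 1 ≤ p) (hG : MemW G p) : WellCovered G := by
  intro S hS
  let i₀ : Fin p := ⟨0, hp⟩
  obtain ⟨M, hM, -, hSM⟩ := hG.2 (fun i => if i = i₀ then S else ∅)
    (fun i => by by_cases h : i = i₀ <;> simp [h, hS.1, isIndep_empty])
    (fun i j hij => by
      by_cases h : i = i₀
      · simp [h, show j ≠ i₀ from fun hj => hij (h.trans hj.symm)]
      · simp [h])
  have hsub : S ⊆ M i₀ := by simpa using hSM i₀
  have heq : S = M i₀ := by
    refine hsub.antisymm fun x hx => ?_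
    by_contra hxS
    exact hS.2 x hxS ((hM i₀).1.mono (Finset.insert_subset hx hsub))
  rw [heq]
  exact (hM i₀).2

theorem MemW.le_card_fiber {p : ℕ} (hp : 1 ≤ p) (hG : MemW G p) {S : Finset V}
    (hS : IsIndep G S) (hcard : S.card + 1 = alpha G) : p ≤ (fiber G S).card := by
  obtain ⟨q, rfl⟩ : ∃ q, p = q + 1 := ⟨p - 1, by omega⟩
  by_contra! hlt
  let e := (fiber G S).equivFin
  let B : Fin q → Finset V := fun i =>
    if h : (i : ℕ) < (fiber G S).card then {((e.symm ⟨i, h⟩ : fiber G S) : V)} else ∅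
  have hB : ∀ i, ∀ x ∈ B i, ∃ h : x ∈ fiber G S, (e ⟨x, h⟩ : ℕ) = i := by
    intro i x hx
    by_cases h : (i : ℕ) < (fiber G S).card
    · simp only [B, dif_pos h, Finset.mem_singleton] at hx
      subst hx
      exact ⟨Subtype.prop _, by simp⟩
    · simp [B, h] at hx
  have hSB : ∀ i, Disjoint S (B i) := fun i => Finset.disjoint_left.2 fun x hxS hxB =>
    (mem_fiber.1 (hB i x hxB).1).1 hxS
  obtain ⟨M, hM, hdisj, hAM⟩ := hG.2 (Fin.cons S B)
    (fun i => by
      refine Fin.cases ?_ (fun i => ?_) i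
      · simpa using hS
      · by_cases h : (i : ℕ) < (fiber G S).card
        · simpa [B, h] using isIndep_singleton _
        · simpa [B, h] using isIndep_empty)
    (fun i j => by
      refine Fin.cases ?_ (fun i => ?_) i <;> refine Fin.cases ?_ (fun j => ?_) j
      · simp
      · intro _
        simpa using hSB j
      · intro _
        simpa using (hSB i).symm
      · intro hij
        simp only [Fin.cons_succ]
        refine Finset.disjoint_left.2 fun x hi hj => hij ?_
        obtain ⟨_, h1⟩ := hB i x hi
        obtain ⟨_, h2⟩ := hB j x hj
        exact congrArg Fin.succ (Fin.ext (h1.symm.trans h2)))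
  have hSM : S ⊆ M 0 := by simpa using hAM 0
  obtain ⟨x, hxS, hxM⟩ : ∃ x, x ∉ S ∧ insert x S = M 0 := by
    have := (hM 0).2
    obtain ⟨x, hx, h⟩ := Finset.exists_eq_insert_iff.2 ⟨hSM, hcard.trans this.symm⟩
    exact ⟨x, hx, h⟩
  have hxF : x ∈ fiber G S := mem_fiber.2 ⟨hxS, hxM ▸ hM 0⟩
  have hlt' : (e ⟨x, hxF⟩ : ℕ) < q := by
    have := (e ⟨x, hxF⟩).isLt
    omega
  have hxj : x ∈ M (Fin.succ ⟨e ⟨x, hxF⟩, hlt'⟩) := by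
    apply hAM
    rw [Fin.cons_succ]
    simp [B]
  exact Finset.disjoint_left.1 (hdisj _ _ (Fin.succ_ne_zero _)) hxj
    (hxM ▸ Finset.mem_insert_self x S)

theorem memW_of_le_card_fiber {p : ℕ} (hwc : WellCovered G) (hpos : 1 ≤ alpha G)
    (hfib : ∀ S, IsIndep G S → S.card + 1 = alpha G → p ≤ (fiber G S).card) : MemW G p := by
  have hext : ∀ T, IsIndep G T → T.card < alpha G →
      ∃ S, T ⊆ S ∧ IsIndep G S ∧ S.card + 1 = alpha G := by
    intro T hT hlt
    obtain ⟨M, hM, hTM⟩ := hwc.exists_isMaxIndep_superset hT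
    obtain ⟨S, hTS, hSM, hS⟩ := Finset.exists_subsuperset_card_eq hTM
      (n := alpha G - 1) (by omega) (by have := hM.2; omega)
    exact ⟨S, hTS, hM.1.mono hSM, by omega⟩
  refine ⟨?_, fun A hA hdisj => ?_⟩
  · obtain ⟨S, -, hS, hc⟩ := hext ∅ isIndep_empty (by rwa [Finset.card_empty])
    exact (hfib S hS hc).trans (Finset.card_le_univ _)
  obtain ⟨M, hAM, hM⟩ := (Set.toFinite {M : Fin p → Finset V | (∀ i, IsIndep G (M i)) ∧
    ∀ i j, i ≠ j → Disjoint (M i) (M j)}).exists_le_maximal ⟨hA, hdisj⟩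
  obtain ⟨hMi, hMd⟩ := hM.prop
  refine ⟨M, fun i => ⟨hMi i, ?_⟩, hMd, hAM⟩
  by_contra hne
  obtain ⟨S, hMS, hS, hc⟩ := hext (M i) (hMi i) (lt_of_le_of_ne (hMi i).card_le_alpha hne)
  -- A fiber is a clique of size at least `p`, so some member avoids all the `M j`.
  obtain ⟨x, hx, hxM⟩ : ∃ x ∈ fiber G S, ∀ j, x ∉ M j := by
    by_contra! hcon
    have : Nonempty (Fin p) := ⟨i⟩
    choose! f hf using hcon
    have hcard : (Finset.univ.erase i).card < (fiber G S).card := by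
      rw [Finset.card_erase_of_mem (Finset.mem_univ i), Finset.card_fin]
      have := hfib S hS hc
      have := i.isLt
      omega
    obtain ⟨x, hx, y, hy, hxy, hfxy⟩ := Finset.exists_ne_map_eq_of_card_lt_of_maps_to hcard
      (f := f) (fun x hx => Finset.mem_coe.2 (Finset.mem_erase.2
        ⟨fun h => (mem_fiber.1 hx).1 (hMS (h ▸ hf x hx)), Finset.mem_univ _⟩))
    exact hMi (f x) (hf x hx) (hfxy ▸ hf y hy) hxy (adj_of_mem_fiber hx hy hxy)
  have hle : M ≤ Function.update M i (insert x (M i)) :=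
    le_update_iff.2 ⟨Finset.subset_insert _ _, fun _ _ => le_rfl⟩
  have hmem : (∀ k, IsIndep G (Function.update M i (insert x (M i)) k)) ∧ ∀ k l, k ≠ l →
      Disjoint (Function.update M i (insert x (M i)) k)
        (Function.update M i (insert x (M i)) l) := by
    constructor
    · intro k
      by_cases hk : k = i
      · subst hk
        simpa using (mem_fiber.1 hx).2.1.mono (Finset.insert_subset_insert x hMS)
      · simpa [hk] using hMi k
    · intro k l hkl
      by_cases hk : k = i
      · subst hk
        simpa [hkl.symm, hxM] using hMd k l hkl
      · by_cases hl : l = i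
        · subst hl
          simpa [hkl, hxM] using hMd k l hkl
        · simpa [hk, hl] using hMd k l hkl
  have := hM.le_of_ge hmem hle i
  simp only [Function.update_self] at this
  exact hxM i (this (Finset.mem_insert_self x _))

theorem AlphaCritical.exists_mem_fiber (hG : AlphaCritical G) {x y : V} (hxy : G.Adj x y) :
    ∃ S, IsIndep G S ∧ S.card + 1 = alpha G ∧ x ∈ fiber G S ∧ y ∈ fiber G S := by
  obtain ⟨T, hT, hTc⟩ := exists_isMaxIndep (G.deleteEdges {s(x, y)})
  have hlt : alpha G < T.card := hTc ▸ hG x y hxy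
  have key : ∀ U ⊆ T, (x ∉ U ∨ y ∉ U) → IsIndep G U := by
    intro U hU hor a ha b hb hab hadj
    refine hT (hU ha) (hU hb) hab ?_
    rw [SimpleGraph.deleteEdges_adj]
    refine ⟨hadj, fun h => ?_⟩
    rw [Set.mem_singleton_iff, Sym2.eq_iff] at h
    rcases h with ⟨rfl, rfl⟩ | ⟨rfl, rfl⟩ <;> tauto
  have hmem : x ∈ T ∧ y ∈ T := by
    by_contra h
    have := (key T subset_rfl (by tauto)).card_le_alpha
    omega
  have hx := key (T.erase x) (Finset.erase_subset _ _) (by simp)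
  have hy := key (T.erase y) (Finset.erase_subset _ _) (by simp)
  have hxc := hx.card_le_alpha
  have hne := hxy.ne
  have hinsx : insert x ((T.erase x).erase y) = T.erase y := by
    ext a; simp only [Finset.mem_insert, Finset.mem_erase]; grind
  have hinsy : insert y ((T.erase x).erase y) = T.erase x := by
    ext a; simp only [Finset.mem_insert, Finset.mem_erase]; grind
  have h1 := Finset.card_erase_add_one hmem.1
  have h2 := Finset.card_erase_add_one hmem.2
  have h3 := Finset.card_erase_add_one (Finset.mem_erase.2 ⟨hne.symm, hmem.2⟩)
  refine ⟨(T.erase x).erase y, hx.mono (Finset.erase_subset _ _), by omega,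
    mem_fiber.2 ⟨by simp, ?_⟩, mem_fiber.2 ⟨by simp, ?_⟩⟩
  · rw [hinsx]
    exact ⟨hy, by omega⟩
  · rw [hinsy]
    exact ⟨hx, by omega⟩

theorem alpha_lt_alpha_deleteEdges {S : Finset V} {x y : V} (hxy : x ≠ y)
    (hx : x ∈ fiber G S) (hy : y ∈ fiber G S) : alpha G < alpha (G.deleteEdges {s(x, y)}) := by
  rw [mem_fiber] at hx hy
  obtain ⟨hxS, hxi, hxc⟩ := hx
  obtain ⟨hyS, hyi, -⟩ := hy
  have hind : IsIndep (G.deleteEdges {s(x, y)}) (insert y (insert x S)) := by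
    intro a ha b hb hab hadj
    rw [SimpleGraph.deleteEdges_adj, Set.mem_singleton_iff, Sym2.eq_iff] at hadj
    obtain ⟨hadj, hne⟩ := hadj
    have h1 := @hxi a
    have h2 := @hyi a
    simp only [Finset.mem_insert] at ha hb h1 h2
    grind
  have hle := hind.card_le_alpha
  rw [Finset.card_insert_of_notMem (by simp [hyS, hxy.symm])] at hle
  omega

end Independence

/-- Main characterization, graph form. -/
theorem alphaCritical_and_wp_iff {V : Type*} [Fintype V] [DecidableEq V]
    (G : SimpleGraph V) (p r : ℕ) (hp : 1 ≤ p) (halpha : alpha G = r) :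
    (AlphaCritical G ∧ MemW G p) ↔
      (WellCovered G ∧
        (∀ S : Finset V, IsIndep G S → S.card = r - 1 → p ≤ (fiber G S).card) ∧
        ∀ x y : V, G.Adj x y ↔
          (x ≠ y ∧ ∃ S : Finset V, IsIndep G S ∧ S.card = r - 1 ∧
            x ∈ fiber G S ∧ y ∈ fiber G S)) := by
  subst halpha
  constructor
  · rintro ⟨hcrit, hW⟩
    have hpos := hW.alpha_pos hp
    refine ⟨hW.wellCovered hp, fun S hS hc => hW.le_card_fiber hp hS (by omega),
      fun x y => ⟨fun hxy => ?_, fun ⟨hne, S, _, _, hx, hy⟩ => adj_of_mem_fiber hx hy hne⟩⟩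
    obtain ⟨S, hS, hc, hx, hy⟩ := hcrit.exists_mem_fiber hxy
    exact ⟨hxy.ne, S, hS, by omega, hx, hy⟩
  · rintro ⟨hwc, hfib, hadj⟩
    have hpos : 1 ≤ alpha G := by
      by_contra! h
      obtain ⟨x, hx⟩ := Finset.card_pos.1 (hp.trans (hfib ∅ isIndep_empty (by simp; omega)))
      have := (isIndep_singleton (G := G) x).card_le_alpha
      rw [Finset.card_singleton] at this
      omega
    refine ⟨fun x y hxy => ?_, memW_of_le_card_fiber hwc hpos
      fun S hS hc => hfib S hS (by omega)⟩
    obtain ⟨hne, S, -, -, hx, hy⟩ := (hadj x y).1 hxy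
    exact alpha_lt_alpha_deleteEdges hne hx hy
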